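/- Let a, b, c > 0 with a+b < c < a+b+1. Then x^{a+b−c}·M(a,b,c,x) → Γ(c)Γ(a+b+1−c)/(Γ(a)Γ(b)) as x → 0+, and (1−x)^{a+b−c}·M(a,b,c,x) → Γ(c)Γ(a+b+1−c)/(Γ(a)Γ(b)) as x → 1−. -/

import Mathlib

open Filter Set

/-- Shifted factorial (Appell symbol) `(a,n) = a(a+1)⋯(a+n−1)`, with `(a,0)=1`. -/
noncomputable def shiftedFact (a : ℝ) (n : ℕ) : ℝ := ∏ i ∈ Finset.range n, (a + i)

/-- Gaussian hypergeometric function `F(a,b;c;x)` as a real power series. -/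
noncomputable def hypF (a b c x : ℝ) : ℝ :=
  ∑' n : ℕ, (shiftedFact a n * shiftedFact b n / (shiftedFact c n * (n.factorial : ℝ))) * x ^ n

/-- Beta function `B(x,y) = Γ(x)Γ(y)/Γ(x+y)`. -/
noncomputable def betaR (x y : ℝ) : ℝ := Real.Gamma x * Real.Gamma y / Real.Gamma (x + y)

/-- `M(a,b,c,x) = x(1−x)(v₁(x)v'(x) − v(x)v₁'(x))` with `v(x)=F(a,b;c;x)`, `v₁(x)=F(a,b;c;1−x)`. -/
noncomputable def Mfun (a b c x : ℝ) : ℝ :=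
  x * (1 - x) * (hypF a b c (1 - x) * deriv (fun t => hypF a b c t) x
    - hypF a b c x * deriv (fun t => hypF a b c (1 - t)) x)

open scoped Topology

lemma shiftedFact_pos {a : ℝ} (ha : 0 < a) (n : ℕ) : 0 < shiftedFact a n :=
  Finset.prod_pos fun i _ => by positivity

lemma shiftedFact_succ (a : ℝ) (n : ℕ) :
    shiftedFact a (n + 1) = shiftedFact a n * (a + n) :=
  Finset.prod_range_succ _ _

lemma shiftedFact_eq_ascPochhammer_eval (a : ℝ) (n : ℕ) :
    shiftedFact a n = (ascPochhammer ℝ n).eval a := by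
  induction n with
  | zero => simp [shiftedFact]
  | succ n ih => rw [shiftedFact_succ, ascPochhammer_succ_eval, ih]

/-- The binomial series `∑ (s,n)/n! xⁿ = (1 - x)⁻ˢ`. -/
lemma hasSum_shiftedFact_div_factorial (s : ℝ) {x : ℝ} (hx : |x| < 1) :
    HasSum (fun n : ℕ => shiftedFact s n / n.factorial * x ^ n) (1 / (1 - x) ^ s) := by
  have h := (Real.one_div_one_sub_rpow_hasFPowerSeriesOnBall_zero s).hasSum (y := x)
    (by simpa [enorm_eq_nnnorm, ← NNReal.coe_lt_coe] using hx)
  rw [zero_add] at h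
  convert! h using 2 with n
  have h2 := Ring.factorial_nsmul_multichoose_eq_ascPochhammer s n
  rw [Polynomial.ascPochhammer_smeval_eq_eval, ← shiftedFact_eq_ascPochhammer_eval, nsmul_eq_mul] at h2
  have h3 : Ring.choose (s + n - 1) n = Ring.multichoose s n := by
    rw [Ring.choose]; congr 1; ring
  have h4 : (n.factorial : ℝ) ≠ 0 := by positivity
  rw [FormalMultilinearSeries.ofScalars_apply_eq, h3, ← h2, smul_eq_mul]
  field_simp

section Abelian

variable {w d : ℕ → ℝ} {L s : ℝ}

lemma summable_mul_pow_of_tendsto_div (hd : ∀ n, 0 < d n)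
    (hs : ∀ x : ℝ, |x| < 1 → Summable fun n => d n * x ^ n)
    (hw : Tendsto (fun n => w n / d n) atTop (𝓝 L)) {x : ℝ} (hx : |x| < 1) :
    Summable fun n => w n * x ^ n := by
  have h1 : w =O[atTop] d :=
    Asymptotics.isBigO_of_div_tendsto_nhds (Eventually.of_forall fun n h => absurd h (hd n).ne') L hw
  exact summable_of_isBigO_nat (hs |x| (by simpa using hx)).norm
    ((h1.mul (Asymptotics.isBigO_refl (fun n => x ^ n) atTop)).norm_right.congr_right
      fun n => by simp)

/-- An Abelian theorem for comparison with the binomial series, null case. -/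
lemma tendsto_rpow_mul_tsum_zero (hd : ∀ n, 0 < d n) (hs0 : 0 < s)
    (hs : ∀ x : ℝ, |x| < 1 → HasSum (fun n => d n * x ^ n) (1 / (1 - x) ^ s))
    (hw : Tendsto (fun n => w n / d n) atTop (𝓝 0)) :
    Tendsto (fun x : ℝ => (1 - x) ^ s * ∑' n, w n * x ^ n) (𝓝[<] 1) (𝓝 0) := by
  rw [Metric.tendsto_nhds]
  intro ε hε
  obtain ⟨N, hN⟩ := eventually_atTop.1 (Metric.tendsto_nhds.1 hw (ε / 2) (by positivity))
  set C := ∑ n ∈ Finset.range N, |w n| with hC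
  have hlim : Tendsto (fun x : ℝ => (1 - x) ^ s * C) (𝓝[<] 1) (𝓝 0) := by
    have : ContinuousAt (fun x : ℝ => (1 - x) ^ s * C) 1 := by
      refine ContinuousAt.mul (ContinuousAt.rpow_const (by fun_prop) (Or.inr hs0.le)) (by fun_prop)
    have h := this.tendsto.mono_left (nhdsWithin_le_nhds (s := Iio 1))
    simpa [Real.zero_rpow hs0.ne'] using h
  have hpos : ∀ᶠ x : ℝ in 𝓝[<] 1, x ∈ Ioo 0 1 := Ioo_mem_nhdsLT one_pos
  filter_upwards [hlim.eventually (gt_mem_nhds (half_pos hε)), hpos] with x hx1 ⟨hx0, hx⟩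
  have hax : |x| < 1 := by rwa [abs_of_pos hx0]
  have hD := hs x hax
  have hpow : 0 < (1 - x) ^ s := Real.rpow_pos_of_pos (by linarith) s
  have hF : HasSum (fun n => if n ∈ Finset.range N then |w n| else 0) C := by
    have := hasSum_sum_of_ne_finset_zero (L := .unconditional ℕ) (f := fun n => if n ∈ Finset.range N then |w n| else 0)
      (s := Finset.range N) (fun n hn => if_neg hn)
    rwa [Finset.sum_congr rfl fun n hn => if_pos hn] at this
  have hb : ‖∑' n, w n * x ^ n‖ ≤ C + ε / 2 * (1 / (1 - x) ^ s) := by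
    refine tsum_of_norm_bounded (hF.add (hD.mul_left (ε / 2))) fun n => ?_
    have hxn : 0 ≤ x ^ n := by positivity
    rw [norm_mul, Real.norm_eq_abs, Real.norm_eq_abs, abs_of_nonneg hxn]
    have hdn := hd n
    by_cases hn : n ∈ Finset.range N
    · rw [if_pos hn]
      have : |w n| * x ^ n ≤ |w n| :=
        mul_le_of_le_one_right (abs_nonneg _) (pow_le_one₀ hx0.le hx.le)
      have : 0 ≤ ε / 2 * (d n * x ^ n) := by positivity
      linarith
    · rw [if_neg hn, zero_add, ← mul_assoc]
      have h := hN n (by simpa using hn)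
      rw [Real.dist_eq, sub_zero, abs_div, abs_of_pos hdn, div_lt_iff₀ hdn] at h
      gcongr
  rw [Real.dist_eq, sub_zero, abs_mul, abs_of_pos hpow]
  calc (1 - x) ^ s * |∑' n, w n * x ^ n|
      ≤ (1 - x) ^ s * (C + ε / 2 * (1 / (1 - x) ^ s)) := by gcongr; exact hb
    _ = (1 - x) ^ s * C + ε / 2 := by field_simp
    _ < ε := by linarith

/-- An Abelian theorem for comparison with the binomial series. -/
lemma tendsto_rpow_mul_tsum (hd : ∀ n, 0 < d n) (hs0 : 0 < s)
    (hs : ∀ x : ℝ, |x| < 1 → HasSum (fun n => d n * x ^ n) (1 / (1 - x) ^ s))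
    (hw : Tendsto (fun n => w n / d n) atTop (𝓝 L)) :
    Tendsto (fun x : ℝ => (1 - x) ^ s * ∑' n, w n * x ^ n) (𝓝[<] 1) (𝓝 L) := by
  have h0 : Tendsto (fun n => (w n - L * d n) / d n) atTop (𝓝 0) := by
    have := hw.sub_const L
    rw [sub_self] at this
    refine this.congr fun n => ?_
    have := (hd n).ne'
    field_simp
  have h := (tendsto_rpow_mul_tsum_zero hd hs0 hs h0).add_const L
  rw [zero_add] at h
  refine h.congr' ?_
  have hpos : ∀ᶠ x : ℝ in 𝓝[<] 1, x ∈ Ioo 0 1 := Ioo_mem_nhdsLT one_pos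
  filter_upwards [hpos] with x ⟨hx0, hx⟩
  have hax : |x| < 1 := by rwa [abs_of_pos hx0]
  have hpow : 0 < (1 - x) ^ s := Real.rpow_pos_of_pos (by linarith) s
  have h1 := summable_mul_pow_of_tendsto_div hd (fun x hx => (hs x hx).summable) hw hax
  have h2 := (h1.hasSum.sub ((hs x hax).mul_left L)).tsum_eq
  have h3 : ∑' n, (w n - L * d n) * x ^ n = ∑' n, w n * x ^ n - L * (1 / (1 - x) ^ s) := by
    rw [← h2]; congr 1; ext n; ring
  rw [h3]
  field_simp
  ring

end Abelian

/-- A power series whose formal derivative converges on `(-1, 1)` is differentiable there. -/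
lemma hasDerivAt_tsum_mul_pow {u : ℕ → ℝ}
    (hu : ∀ x : ℝ, |x| < 1 → Summable fun n : ℕ => (n + 1) * u (n + 1) * x ^ n)
    {x : ℝ} (hx : |x| < 1) :
    HasDerivAt (fun t : ℝ => ∑' n, u n * t ^ n) (∑' n : ℕ, (n + 1) * u (n + 1) * x ^ n) x := by
  obtain ⟨r, hxr, hr⟩ := exists_between hx
  have hr0 : 0 < r := (abs_nonneg x).trans_lt hxr
  have hsum : Summable fun n : ℕ => |u n * (n * r ^ (n - 1))| := by
    rw [← summable_nat_add_iff 1]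
    refine (hu r (by rwa [abs_of_pos hr0])).abs.congr fun n => ?_
    push_cast
    congr 1
    ring
  have key := hasDerivAt_tsum_of_isPreconnected (t := Ioo (-r) r) (y₀ := 0) (y := x)
    (g := fun n t => u n * t ^ n) (g' := fun n t => u n * (n * t ^ (n - 1)))
    hsum isOpen_Ioo isPreconnected_Ioo
    (fun n y _ => (hasDerivAt_pow n y).const_mul (u n))
    (fun n y hy => by
      have hy' : |y| ≤ |r| := by rw [abs_of_pos hr0]; exact (abs_lt.2 hy).le
      rw [Real.norm_eq_abs, abs_mul, abs_mul, abs_mul, abs_mul, abs_pow, abs_pow]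
      gcongr)
    ⟨by linarith, hr0⟩
    (summable_of_ne_finset_zero (s := {0}) fun n hn => by simp_all)
    (abs_lt.1 hxr)
  convert! key using 1
  have hs' : Summable fun n : ℕ => u n * (n * x ^ (n - 1)) := by
    rw [← summable_nat_add_iff 1]
    refine (hu x hx).congr fun n => ?_
    push_cast
    ring
  rw [hs'.tsum_eq_zero_add]
  simp only [Nat.cast_zero, zero_mul, mul_zero, zero_add, Nat.add_sub_cancel]
  congr 1; ext n; push_cast; ring

lemma continuousAt_tsum_mul_pow_zero {u : ℕ → ℝ}
    (hu : ∀ x : ℝ, |x| < 1 → Summable fun n : ℕ => u n * x ^ n) :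
    ContinuousAt (fun t : ℝ => ∑' n, u n * t ^ n) 0 := by
  have h : ContinuousOn (fun t : ℝ => ∑' n, u n * t ^ n) (Icc (-(1 / 2)) (1 / 2)) := by
    refine continuousOn_tsum (u := fun n => |u n * (1 / 2) ^ n|) (fun n => by fun_prop)
      (hu (1 / 2) (by norm_num [abs_of_pos])).abs fun n t ht => ?_
    rw [Real.norm_eq_abs, abs_mul, abs_mul, abs_pow, abs_pow]
    have : |t| ≤ |1 / 2| := (abs_le.2 ht).trans (le_abs_self _)
    gcongr
  exact h.continuousAt (Icc_mem_nhds (by norm_num) (by norm_num))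

/-- The Taylor coefficients of `hypF`. -/
noncomputable def hypCoeff (a b c : ℝ) (n : ℕ) : ℝ :=
  shiftedFact a n * shiftedFact b n / (shiftedFact c n * (n.factorial : ℝ))

lemma tendsto_deriv_hypCoeff_div {a b c : ℝ} (ha : 0 < a) (hb : 0 < b) (hc : 0 < c)
    (hs : 0 < a + b + 1 - c) :
    Tendsto (fun n : ℕ => (n + 1) * hypCoeff a b c (n + 1) /
        (shiftedFact (a + b + 1 - c) n / n.factorial)) atTop
      (𝓝 (Real.Gamma c * Real.Gamma (a + b + 1 - c) / (Real.Gamma a * Real.Gamma b))) := by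
  set s := a + b + 1 - c with hsdef
  have h1 : Tendsto (fun n : ℕ => 1 + s / (n : ℝ)) atTop (𝓝 1) := by
    simpa using (tendsto_const_div_atTop_nhds_zero_nat s).const_add 1
  have h2 := h1.mul (((Real.GammaSeq_tendsto_Gamma c).mul (Real.GammaSeq_tendsto_Gamma s)).div
    ((Real.GammaSeq_tendsto_Gamma a).mul (Real.GammaSeq_tendsto_Gamma b))
    (mul_pos (Real.Gamma_pos_of_pos ha) (Real.Gamma_pos_of_pos hb)).ne')
  rw [one_mul] at h2
  refine h2.congr' ?_
  filter_upwards [eventually_gt_atTop 0] with n hn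
  have hn' : (0 : ℝ) < n := by exact_mod_cast hn
  have hG : ∀ t : ℝ, Real.GammaSeq t n = (n : ℝ) ^ t * n.factorial / shiftedFact t (n + 1) :=
    fun t => rfl
  have hp : (n : ℝ) ^ s = (n : ℝ) ^ a * (n : ℝ) ^ b * n / (n : ℝ) ^ c := by
    rw [hsdef, Real.rpow_sub hn', Real.rpow_add hn', Real.rpow_add hn', Real.rpow_one]
  simp only [Pi.div_apply, hG, hp, hypCoeff, Nat.factorial_succ]
  rw [shiftedFact_succ s]
  push_cast
  have := (Real.rpow_pos_of_pos hn' a).ne'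
  have := (Real.rpow_pos_of_pos hn' b).ne'
  have := (Real.rpow_pos_of_pos hn' c).ne'
  have := (shiftedFact_pos ha (n + 1)).ne'
  have := (shiftedFact_pos hb (n + 1)).ne'
  have := (shiftedFact_pos hc (n + 1)).ne'
  have := (shiftedFact_pos hs n).ne'
  have : (n.factorial : ℝ) ≠ 0 := by positivity
  have : s + n ≠ 0 := by positivity
  have : (n : ℝ) + 1 ≠ 0 := by positivity
  field_simp
  ring

lemma tendsto_hypCoeff_div {a b c : ℝ} (ha : 0 < a) (hb : 0 < b) (hc : 0 < c)
    (hs : 0 < a + b + 1 - c) :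
    Tendsto (fun n : ℕ => hypCoeff a b c n /
        (shiftedFact (a + b + 1 - c) n / n.factorial)) atTop (𝓝 0) := by
  have hinv : ∀ t : ℝ, Tendsto (fun n : ℕ => (t + (n : ℝ))⁻¹) atTop (𝓝 0) := fun t =>
    (tendsto_atTop_add_const_left _ t tendsto_natCast_atTop_atTop).inv_tendsto_atTop
  have hq : Tendsto (fun n : ℕ => (1 + (c - a) * (a + (n : ℝ))⁻¹) * (b + (n : ℝ))⁻¹)
      atTop (𝓝 0) := by
    simpa using (((hinv a).const_mul (c - a)).const_add 1).mul (hinv b)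
  have h := (tendsto_deriv_hypCoeff_div ha hb hc hs).mul hq
  rw [mul_zero] at h
  refine h.congr fun n => ?_
  simp only [hypCoeff, Nat.factorial_succ, shiftedFact_succ]
  push_cast
  have := (shiftedFact_pos hc n).ne'
  have := (shiftedFact_pos hs n).ne'
  have : (n.factorial : ℝ) ≠ 0 := by positivity
  have : a + n ≠ 0 := by positivity
  have : b + n ≠ 0 := by positivity
  have : c + n ≠ 0 := by positivity
  have : (n : ℝ) + 1 ≠ 0 := by positivity
  field_simp
  ring

lemma Mfun_one_sub (a b c x : ℝ) : Mfun a b c (1 - x) = Mfun a b c x := by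
  have h : ∀ y, deriv (fun t => hypF a b c (1 - t)) y
      = -deriv (fun t => hypF a b c t) (1 - y) := fun y =>
    deriv_comp_const_sub (f := hypF a b c) 1 y
  simp only [Mfun, h, sub_sub_cancel]
  ring

lemma tendsto_Mfun_one {a b c : ℝ} (ha : 0 < a) (hb : 0 < b) (hc : 0 < c)
    (hs : 0 < a + b + 1 - c) :
    Tendsto (fun x : ℝ => (1 - x) ^ (a + b - c) * Mfun a b c x) (𝓝[<] 1)
      (𝓝 (Real.Gamma c * Real.Gamma (a + b + 1 - c) / (Real.Gamma a * Real.Gamma b))) := by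
  set s := a + b + 1 - c with hsdef
  set L := Real.Gamma c * Real.Gamma s / (Real.Gamma a * Real.Gamma b)
  have hd : ∀ n : ℕ, 0 < shiftedFact s n / n.factorial := fun n =>
    div_pos (shiftedFact_pos hs n) (by positivity)
  have hD : ∀ x : ℝ, |x| < 1 → HasSum (fun n : ℕ => shiftedFact s n / n.factorial * x ^ n)
    (1 / (1 - x) ^ s) := fun x hx => hasSum_shiftedFact_div_factorial s hx
  have hDs := fun x hx => (hD x hx).summable
  have hw := tendsto_deriv_hypCoeff_div ha hb hc hs
  have hu := tendsto_hypCoeff_div ha hb hc hs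
  set v' : ℝ → ℝ := fun x => ∑' n : ℕ, (n + 1) * hypCoeff a b c (n + 1) * x ^ n with hv'
  have hv0 : ContinuousAt (hypF a b c) 0 := continuousAt_tsum_mul_pow_zero
    fun x hx => summable_mul_pow_of_tendsto_div hd hDs hu hx
  have hv'0 : ContinuousAt v' 0 := continuousAt_tsum_mul_pow_zero
    fun x hx => summable_mul_pow_of_tendsto_div hd hDs hw hx
  have hderiv : ∀ x : ℝ, |x| < 1 → deriv (fun t => hypF a b c t) x = v' x := fun x hx =>
    (hasDerivAt_tsum_mul_pow (fun x hx => summable_mul_pow_of_tendsto_div hd hDs hw hx) hx).deriv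
  have hval : hypF a b c 0 = 1 := by
    rw [hypF, tsum_eq_single 0 fun n hn => by simp [hn]]
    simp [shiftedFact]
  have hsub : Tendsto (fun x : ℝ => 1 - x) (𝓝[<] 1) (𝓝 0) := by
    have : Tendsto (fun x : ℝ => 1 - x) (𝓝 1) (𝓝 (1 - 1)) := by
      exact (continuous_const.sub continuous_id).tendsto 1
    rw [sub_self] at this
    exact this.mono_left nhdsWithin_le_nhds
  have hid : Tendsto (fun x : ℝ => x) (𝓝[<] 1) (𝓝 1) := nhdsWithin_le_nhds
  have t1 : Tendsto (fun x : ℝ => (1 - x) ^ s * v' x) (𝓝[<] 1) (𝓝 L) :=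
    tendsto_rpow_mul_tsum hd hs hD hw
  have t2 : Tendsto (fun x : ℝ => (1 - x) ^ s * hypF a b c x) (𝓝[<] 1) (𝓝 0) :=
    tendsto_rpow_mul_tsum hd hs hD hu
  have t3 := (hv0.tendsto.comp hsub)
  have t4 := (hv'0.tendsto.comp hsub)
  have h := hid.mul ((t3.mul t1).add (t2.mul t4))
  rw [hval, one_mul, one_mul, zero_mul, add_zero] at h
  refine h.congr' ?_
  have hpos : ∀ᶠ x : ℝ in 𝓝[<] 1, x ∈ Ioo 0 1 := Ioo_mem_nhdsLT one_pos
  filter_upwards [hpos] with x ⟨hx0, hx⟩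
  have hdr : deriv (fun t => hypF a b c (1 - t)) x = -v' (1 - x) := by
    rw [← hderiv (1 - x) (by rw [abs_of_pos] <;> linarith)]
    exact deriv_comp_const_sub (f := hypF a b c) 1 x
  have hp : (1 - x) ^ s = (1 - x) ^ (a + b - c) * (1 - x) := by
    rw [← Real.rpow_add_one (by linarith)]; congr 1; ring
  simp only [Mfun, hdr, hderiv x (by rwa [abs_of_pos hx0]), hp, Function.comp_apply]
  ring

theorem stmt7 (a b c : ℝ) (ha : 0 < a) (hb : 0 < b) (hc : 0 < c)
    (h1 : a + b < c) (h2 : c < a + b + 1) :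
    Tendsto (fun x : ℝ => x ^ (a + b - c) * Mfun a b c x) (nhdsWithin 0 (Set.Ioi 0))
      (nhds (Real.Gamma c * Real.Gamma (a + b + 1 - c) / (Real.Gamma a * Real.Gamma b))) ∧
    Tendsto (fun x : ℝ => (1 - x) ^ (a + b - c) * Mfun a b c x) (nhdsWithin 1 (Set.Iio 1))
      (nhds (Real.Gamma c * Real.Gamma (a + b + 1 - c) / (Real.Gamma a * Real.Gamma b))) := by
  have h := tendsto_Mfun_one ha hb hc (by linarith : 0 < a + b + 1 - c)
  refine ⟨?_, h⟩
  have hsub : Tendsto (fun x : ℝ => 1 - x) (𝓝[>] 0) (𝓝[<] 1) := by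
    refine tendsto_nhdsWithin_iff.2 ⟨?_, ?_⟩
    · have : Tendsto (fun x : ℝ => 1 - x) (𝓝 0) (𝓝 (1 - 0)) :=
        (continuous_const.sub continuous_id).tendsto 0
      rw [sub_zero] at this
      exact this.mono_left nhdsWithin_le_nhds
    · filter_upwards [self_mem_nhdsWithin] with x hx
      have : 0 < x := hx
      show 1 - x < 1
      linarith
  refine (h.comp hsub).congr fun x => ?_
  simp only [Function.comp_apply, Mfun_one_sub, sub_sub_cancel]
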